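/- arXiv:1606.04025 — 3 statements merged into one kernel-verified Lean document; each statement's English description precedes it below -/
import Mathlib

section
/- For an ordinal κ, the space C_p(κ) is Fréchet–Urysohn if and only if the cofinality of κ is at most ω. -/
open Topology

/-- `Cp X` is the space `C(X, ℝ)` endowed with the topology of pointwise convergence. -/
def Cp (X : Type*) [TopologicalSpace X] : Type _ := C(X, ℝ)

namespace Cp

variable {X : Type*} [TopologicalSpace X]

instance : FunLike (Cp X) X ℝ where
  coe f := ⇑(show C(X, ℝ) from f)
  coe_injective := ContinuousMap.coe_injective

/-- The topology of pointwise convergence on `Cp X`. -/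
instance : TopologicalSpace (Cp X) :=
  TopologicalSpace.induced (fun f : Cp X => (f : X → ℝ)) Pi.topologicalSpace

end Cp

/-- A topological space `Y` is Ascoli if the canonical evaluation map
`Y → C_k(C_k(Y))`, `y ↦ (f ↦ f y)`, is a topological embedding (here `C(·, ℝ)`
carries the compact-open topology). -/
def AscoliSpace (Y : Type*) [TopologicalSpace Y] : Prop :=
  IsEmbedding fun y : Y =>
    (⟨fun f : C(Y, ℝ) => f y, ContinuousEvalConst.continuous_eval_const y⟩ : C(C(Y, ℝ), ℝ))

/-- A topological space `Y` is a `k_ℝ`-space if every real-valued function whose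
restriction to every compact subset is continuous is itself continuous. -/
def KRSpace (Y : Type*) [TopologicalSpace Y] : Prop :=
  ∀ g : Y → ℝ, (∀ K : Set Y, IsCompact K → ContinuousOn g K) → Continuous g

/-- A topological space is scattered if every nonempty subset has a point isolated in it. -/
def Scattered (X : Type*) [TopologicalSpace X] : Prop :=
  ∀ A : Set X, A.Nonempty → ∃ a ∈ A, ∃ U : Set X, IsOpen U ∧ U ∩ A = {a}

/-- A space is hemicompact if it has a countable family of compact sets such that every
compact subset is contained in one of them. -/
def Hemicompact (X : Type*) [TopologicalSpace X] : Prop :=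
  ∃ K : ℕ → Set X, (∀ n, IsCompact (K n)) ∧ ∀ C : Set X, IsCompact C → ∃ n, C ⊆ K n

/-- A space is countably compact if every countable open cover has a finite subcover. -/
def CountablyCompact (X : Type*) [TopologicalSpace X] : Prop :=
  ∀ U : ℕ → Set X, (∀ n, IsOpen (U n)) → (⋃ n, U n) = Set.univ →
    ∃ s : Finset ℕ, (⋃ n ∈ s, U n) = Set.univ


open Filter Set

namespace Cp

theorem isInducing_coe {X : Type*} [TopologicalSpace X] :
    IsInducing (fun f : Cp X => (f : X → ℝ)) :=
  ⟨rfl⟩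

theorem tendsto_iff {X ι : Type*} [TopologicalSpace X] {l : Filter ι} {u : ι → Cp X} {f : Cp X} :
    Tendsto u l (𝓝 f) ↔ ∀ x, Tendsto (fun i => u i x) l (𝓝 (f x)) := by
  rw [isInducing_coe.tendsto_nhds_iff, tendsto_pi_nhds]
  rfl

theorem continuous_eval {X : Type*} [TopologicalSpace X] (x : X) :
    Continuous fun f : Cp X => f x :=
  (continuous_apply x).comp isInducing_coe.continuous

/-- A point in the closure of a set is approximated on every finite set by members of the set. -/
theorem exists_forall_abs_sub_lt {X : Type*} [TopologicalSpace X] {A : Set (Cp X)} {g : Cp X}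
    (hg : g ∈ closure A) (F : Finset X) {ε : ℝ} (hε : 0 < ε) :
    ∃ f ∈ A, ∀ x ∈ F, |f x - g x| < ε := by
  have hU : {f : Cp X | ∀ x ∈ F, |f x - g x| < ε} ∈ 𝓝 g := by
    refine (F.eventually_all).2 fun x _ => ?_
    have h : Continuous fun f : Cp X => |f x - g x| :=
      ((continuous_eval x).sub continuous_const).abs
    exact h.continuousAt.eventually_lt continuousAt_const (by simpa using hε)
  obtain ⟨f, hf, hfA⟩ := mem_closure_iff_nhds.1 hg _ hU
  exact ⟨f, hfA, hf⟩

/-- A function that agrees on every finite set with some member of `A` is in the closure of `A`. -/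
theorem mem_closure_of_forall_eqOn {X : Type*} [TopologicalSpace X] {A : Set (Cp X)} {g : Cp X}
    (h : ∀ F : Finset X, ∃ f ∈ A, ∀ x ∈ F, f x = g x) : g ∈ closure A := by
  choose u hu hug using h
  refine mem_closure_of_tendsto (b := atTop) (f := u) (tendsto_iff.2 fun x => ?_)
    (Eventually.of_forall hu)
  refine tendsto_const_nhds.congr' ?_
  filter_upwards [eventually_ge_atTop {x}] with F hF
  exact (hug F x (hF (Finset.mem_singleton_self x))).symm

end Cp

theorem isOpen_Iic_of_wellFoundedLT {X : Type*} [LinearOrder X] [WellFoundedLT X]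
    [TopologicalSpace X] [OrderTopology X] (a : X) : IsOpen (Iic a) := by
  by_cases ha : IsMax a
  · have : Iic a = univ := eq_univ_of_forall fun x => ha.isTop x
    exact this ▸ isOpen_univ
  · let := SuccOrder.ofLinearWellFoundedLT X
    rw [← Order.Iio_succ_of_not_isMax ha]
    exact isOpen_Iio

/-- Below a point `p` of an open set `U` in a linearly ordered space, the points outside `U` are
bounded by some `b < p`. -/
theorem exists_forall_le_notMem_imp {X : Type*} [LinearOrder X] [TopologicalSpace X]
    [OrderTopology X] {U : Set X} {p : X} (hU : U ∈ 𝓝 p) :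
    ∃ b, ∀ x ≤ p, x ∉ U → x ≤ b ∧ b < p := by
  by_cases hp : ∃ l, l < p
  · obtain ⟨b, hb, hbU⟩ := exists_Ioc_subset_of_mem_nhds hU hp
    refine ⟨b, fun x hx hxU => ⟨?_, hb⟩⟩
    by_contra! hlt
    exact hxU (hbU ⟨hlt, hx⟩)
  · refine ⟨p, fun x hx hxU => ?_⟩
    rcases hx.eq_or_lt with rfl | hlt
    · exact absurd (mem_of_mem_nhds hU) hxU
    · exact absurd ⟨x, hlt⟩ hp

/-- Descent along a well-order: if `F n` is an increasing sequence of sets whose union is cofinal,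
and every point `p ∈ F n` comes with a point of `F (n + 1)` that is below `p` and bounds the part
of the complement of `U n` below `p`, then each point is in all but finitely many `U n`. -/
theorem eventually_mem_of_descent {X : Type*} [LinearOrder X] [WellFoundedLT X]
    {F U : ℕ → Set X} (hF : Monotone F) (hcof : ∀ x, ∃ n, ∃ y ∈ F n, x ≤ y)
    (hstep : ∀ n, ∀ p ∈ F n, ∃ b ∈ F (n + 1), ∀ x ≤ p, x ∉ U n → x ≤ b ∧ b < p) (x : X) :
    ∀ᶠ n in atTop, x ∈ U n := by
  have hne : {p | (∃ n, p ∈ F n) ∧ x ≤ p}.Nonempty := by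
    obtain ⟨n, y, hy, hxy⟩ := hcof x
    exact ⟨y, ⟨n, hy⟩, hxy⟩
  obtain ⟨p, ⟨⟨N, hpN⟩, hxp⟩, hmin⟩ := WellFounded.has_min (wellFounded_lt (α := X)) _ hne
  filter_upwards [eventually_ge_atTop N] with n hn
  by_contra hx
  obtain ⟨b, hbF, hb⟩ := hstep n p (hF hn hpN)
  obtain ⟨hxb, hbp⟩ := hb x hxp hx
  exact hmin b ⟨⟨n + 1, hbF⟩, hxb⟩ hbp

theorem Cp.frechetUrysohnSpace_of_isCofinal_range {X : Type*} [LinearOrder X] [WellFoundedLT X]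
    [TopologicalSpace X] [OrderTopology X] {a : ℕ → X} (ha : IsCofinal (range a)) :
    FrechetUrysohnSpace (Cp X) := by
  refine ⟨fun A g hg => ?_⟩
  have hε (n : ℕ) : (0 : ℝ) < 1 / (n + 1) := Nat.one_div_pos_of_nat
  choose f hfA hfg using fun (F : Finset X) (n : ℕ) => exists_forall_abs_sub_lt hg F (hε n)
  let U (F : Finset X) (n : ℕ) : Set X := {x | |f F n x - g x| < 1 / (n + 1)}
  have hU (F : Finset X) (n : ℕ) : IsOpen (U F n) := by
    have hf : Continuous (f F n) := ContinuousMap.continuous (show C(X, ℝ) from f F n)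
    have hg : Continuous g := ContinuousMap.continuous (show C(X, ℝ) from g)
    exact isOpen_lt (hf.sub hg).abs continuous_const
  have hb (F : Finset X) (n : ℕ) (p : X) :
      ∃ b, p ∈ U F n → ∀ x ≤ p, x ∉ U F n → x ≤ b ∧ b < p := by
    by_cases hp : p ∈ U F n
    · obtain ⟨b, hb⟩ := exists_forall_le_notMem_imp ((hU F n).mem_nhds hp)
      exact ⟨b, fun _ => hb⟩
    · exact ⟨p, fun h => absurd h hp⟩
  choose b hb using hb
  let F (n : ℕ) : Finset X :=
    Nat.rec {a 0} (fun n G => G ∪ ({a (n + 1)} ∪ G.image (b G n))) n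
  have hFsucc (n : ℕ) : F (n + 1) = F n ∪ ({a (n + 1)} ∪ (F n).image (b (F n) n)) := rfl
  have haF (n : ℕ) : a n ∈ F n := by
    cases n with
    | zero => exact Finset.mem_singleton_self _
    | succ n => simp [hFsucc]
  refine ⟨fun n => f (F n) n, fun n => hfA _ _, tendsto_iff.2 fun x => ?_⟩
  have hev : ∀ᶠ n in atTop, x ∈ U (F n) n := by
    refine eventually_mem_of_descent (F := fun n => {y | y ∈ F n}) (U := fun n => U (F n) n)
      ?_ ?_ ?_ x
    · refine monotone_nat_of_le_succ fun n => ?_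
      rw [hFsucc]
      exact Finset.coe_subset.2 Finset.subset_union_left
    · intro x
      obtain ⟨_, ⟨n, rfl⟩, hn⟩ := ha x
      exact ⟨n, a n, haF n, hn⟩
    · intro n p hp
      refine ⟨b (F n) n p, ?_, hb _ _ _ (hfg _ _ _ hp)⟩
      rw [hFsucc]
      exact Finset.mem_coe.2 <| Finset.mem_union_right _ <| Finset.mem_union_right _ <|
        Finset.mem_image_of_mem _ hp
  rw [tendsto_iff_dist_tendsto_zero]
  refine squeeze_zero' (Eventually.of_forall fun _ => dist_nonneg) ?_
    (tendsto_one_div_add_atTop_nhds_zero_nat (𝕜 := ℝ))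
  filter_upwards [hev] with n hn
  exact le_of_lt hn

theorem Cp.exists_countable_isCofinal {X : Type*} [LinearOrder X] [WellFoundedLT X]
    [TopologicalSpace X] [OrderTopology X] [FrechetUrysohnSpace (Cp X)] :
    ∃ s : Set X, s.Countable ∧ IsCofinal s := by
  cases isEmpty_or_nonempty X
  · exact ⟨∅, countable_empty, .of_isEmpty⟩
  have hclopen (a : X) : IsClopen (Ioi a) := by
    rw [← compl_Iic]
    exact IsClopen.compl ⟨isClosed_Iic, isOpen_Iic_of_wellFoundedLT a⟩
  let χ (a : X) : Cp X :=
    show C(X, ℝ) from ⟨(Ioi a).indicator 1, (hclopen a).continuous_indicator continuous_one⟩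
  have hχ (a x : X) : χ a x = (Ioi a).indicator 1 x := rfl
  let z : Cp X := show C(X, ℝ) from 0
  have hz : z ∈ closure (range χ) := by
    refine mem_closure_of_forall_eqOn fun F => ?_
    obtain ⟨m, hm⟩ := F.exists_le
    exact ⟨χ m, mem_range_self m, fun x hx => indicator_of_notMem (not_lt.2 (hm x hx)) _⟩
  obtain ⟨u, hu, hlim⟩ := mem_closure_iff_seq_limit.1 hz
  choose a ha using hu
  refine ⟨range a, countable_range a, ?_⟩
  by_contra hcof
  obtain ⟨x, hx⟩ := not_isCofinal_iff.1 hcof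
  have hone (n : ℕ) : u n x = 1 := by
    rw [← ha, hχ, indicator_of_mem (mem_Ioi.2 (hx _ (mem_range_self n))), Pi.one_apply]
  have h := tendsto_iff.1 hlim x
  simp only [hone] at h
  exact one_ne_zero (tendsto_nhds_unique tendsto_const_nhds h)

/-- For a well-ordered space, `C_p(X)` is Fréchet–Urysohn iff `X` has countable cofinality. -/
theorem Cp.frechetUrysohnSpace_iff_cof_le_aleph0 {X : Type*} [LinearOrder X] [WellFoundedLT X]
    [TopologicalSpace X] [OrderTopology X] :
    FrechetUrysohnSpace (Cp X) ↔ Order.cof X ≤ Cardinal.aleph0 := by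
  constructor
  · intro _
    obtain ⟨s, hs, hcof⟩ := exists_countable_isCofinal (X := X)
    exact (Order.cof_le hcof).trans hs.le_aleph0
  · intro h
    cases isEmpty_or_nonempty X
    · refine ⟨fun A g hg => ?_⟩
      obtain ⟨f, hf⟩ := closure_nonempty_iff.1 ⟨g, hg⟩
      exact ⟨fun _ => f, fun _ => hf, tendsto_iff.2 isEmptyElim⟩
    · obtain ⟨s, hcof, hs⟩ := Order.exists_cof_eq X
      obtain ⟨a, rfl⟩ := (Cardinal.le_aleph0_iff_set_countable.1 (hs.trans_le h)).exists_eq_range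
        hcof.nonempty
      exact frechetUrysohnSpace_of_isCofinal_range hcof

/-- For an ordinal `κ`, the space `C_p(κ)` is Fréchet–Urysohn if and only if
the cofinality of `κ` is at most `ω`. -/
theorem cp_ordinal_frechetUrysohn_iff (κ : Ordinal) :
    FrechetUrysohnSpace (Cp (Set.Iio κ)) ↔ κ.cof ≤ Cardinal.aleph0 := by
  rw [Cp.frechetUrysohnSpace_iff_cof_le_aleph0, Ordinal.cof_Iio, ← Ordinal.lift_cof, Cardinal.lift_le_aleph0]
end

section
/- For an ordinal κ whose cofinality is at most ω, the space C_k(κ) of continuous real-valued functions on κ with the compact-open topology is completely metrizable, i.e., its topology is induced by a complete metric. -/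
open Topology

open Set

theorem Ordinal.isCompact_Iic_Iio {κ : Ordinal} (a : Iio κ) : IsCompact (Iic a) := by
  have himage : Subtype.val '' Iic a = Icc (0 : Ordinal) a := by
    ext x
    constructor
    · rintro ⟨y, hy, rfl⟩
      exact ⟨zero_le, hy⟩
    · rintro ⟨-, hx⟩
      exact ⟨⟨x, hx.trans_lt a.2⟩, hx, rfl⟩
  rw [Subtype.isCompact_iff, himage]
  exact isCompact_Icc

theorem Ordinal.weaklyLocallyCompactSpace_Iio (κ : Ordinal) :
    WeaklyLocallyCompactSpace (Iio κ) where
  exists_compact_mem_nhds a := by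
    refine ⟨Iic a, isCompact_Iic_Iio a, ?_⟩
    have hpre : (Subtype.val : Iio κ → Ordinal) ⁻¹' Iio (Order.succ (a : Ordinal)) = Iic a := by
      ext x
      exact Order.lt_succ_iff (a := (x : Ordinal))
    rw [← hpre]
    exact (isOpen_Iio.preimage continuous_subtype_val).mem_nhds (Order.lt_succ (a : Ordinal))

theorem Ordinal.sigmaCompactSpace_Iio {κ : Ordinal} (h : κ.cof ≤ Cardinal.aleph0) :
    SigmaCompactSpace (Iio κ) := by
  obtain ⟨s, hs, hcard⟩ := Order.exists_cof_eq (Iio κ)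
  have hcount : s.Countable := by
    rw [← Cardinal.le_aleph0_iff_set_countable, hcard, cof_Iio, ← lift_cof]
    exact Cardinal.lift_le_aleph0.2 h
  refine SigmaCompactSpace.of_countable (Iic '' s) (hcount.image _) ?_ ?_
  · rintro _ ⟨a, -, rfl⟩
    exact isCompact_Iic_Iio a
  · refine eq_univ_of_forall fun x => ?_
    obtain ⟨a, ha, hxa⟩ := hs x
    exact ⟨Iic a, mem_image_of_mem _ ha, hxa⟩

/-- For an ordinal `κ` with `cf(κ) ≤ ω`, the space `C_k(κ)` (with the compact-open
topology) is completely metrizable: its topology is induced by a complete metric. -/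
theorem ck_ordinal_completelyMetrizable (κ : Ordinal) (h : κ.cof ≤ Cardinal.aleph0) :
    ∃ m : MetricSpace C(Set.Iio κ, ℝ),
      m.toUniformSpace.toTopologicalSpace = ContinuousMap.compactOpen ∧
      @CompleteSpace C(Set.Iio κ, ℝ) m.toUniformSpace := by
  have := Ordinal.weaklyLocallyCompactSpace_Iio κ
  have := Ordinal.sigmaCompactSpace_Iio h
  exact ⟨UniformSpace.metricSpace C(Set.Iio κ, ℝ), rfl, inferInstance⟩
end

section
/- Let X be a locally compact Hausdorff topological space. Then C_p(X) is an Ascoli space if and only if X is scattered. -/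
open Topology

open Set

/-- A continuous image of a compact set is the image of a minimal compact subset. -/
lemma exists_minimal_isCompact_image_eq {X Z : Type*} [TopologicalSpace X] [T2Space X]
    [TopologicalSpace Z] [T1Space Z] {φ : X → Z} (hφ : Continuous φ) {K : Set X}
    (hK : IsCompact K) :
    ∃ E ⊆ K, IsCompact E ∧ φ '' E = φ '' K ∧
      ∀ C ⊆ E, IsClosed C → φ '' C = φ '' K → C = E := by
  let S : Set (Set X) := {E | IsClosed E ∧ E ⊆ K ∧ φ '' E = φ '' K}
  have hzorn : ∀ c ⊆ S, IsChain (· ⊆ ·) c → c.Nonempty → ∃ lb ∈ S, ∀ s ∈ c, lb ⊆ s := by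
    intro c hc hchain hne
    have : Nonempty c := hne.to_subtype
    refine ⟨⋂₀ c, ⟨isClosed_sInter fun E hE => (hc hE).1, ?_, ?_⟩,
      fun E hE => sInter_subset_of_mem hE⟩
    · obtain ⟨E, hE⟩ := hne
      exact (sInter_subset_of_mem hE).trans (hc hE).2.1
    · refine Subset.antisymm ?_ fun z hz => ?_
      · obtain ⟨E, hE⟩ := hne
        exact image_mono ((sInter_subset_of_mem hE).trans (hc hE).2.1)
      · have hclosed : ∀ E : c, IsClosed ((E : Set X) ∩ φ ⁻¹' {z}) := fun E =>
          (hc E.2).1.inter (isClosed_singleton.preimage hφ)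
        have hinter := IsCompact.nonempty_iInter_of_directed_nonempty_isCompact_isClosed
          (fun E : c => (E : Set X) ∩ φ ⁻¹' {z})
          (fun E F => by
            rcases hchain.total E.2 F.2 with h | h
            · exact ⟨E, Subset.rfl, inter_subset_inter_left _ h⟩
            · exact ⟨F, inter_subset_inter_left _ h, Subset.rfl⟩)
          (fun E => by
            obtain ⟨x, hx, hxz⟩ := (hc E.2).2.2.symm ▸ hz
            exact ⟨x, hx, hxz⟩)
          (fun E => hK.of_isClosed_subset (hclosed E) (inter_subset_left.trans (hc E.2).2.1))
          hclosed
        obtain ⟨x, hx⟩ := hinter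
        rw [mem_iInter] at hx
        obtain ⟨E⟩ := this
        exact ⟨x, fun F hF => (hx ⟨F, hF⟩).1, (hx E).2⟩
  obtain ⟨E, hEK, hE⟩ := zorn_superset_nonempty S hzorn K ⟨hK.isClosed, Subset.rfl, rfl⟩
  refine ⟨E, hEK, hK.of_isClosed_subset hE.prop.1 hEK, hE.prop.2.2, fun C hCE hC hCK => ?_⟩
  exact hE.eq_of_subset ⟨hC, hCE.trans hEK, hCK⟩ hCE

/-- A continuous map from a compact scattered space to a second countable Hausdorff space has
countable range. -/
lemma Scattered.countable_range {X Z : Type*} [TopologicalSpace X] [CompactSpace X] [T2Space X]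
    [TopologicalSpace Z] [T2Space Z] [SecondCountableTopology Z] (hX : Scattered X)
    {φ : X → Z} (hφ : Continuous φ) : (range φ).Countable := by
  by_contra hunc
  obtain ⟨P, hP, hPne, hPφ⟩ := exists_perfect_nonempty_of_isClosed_of_not_countable
    (isCompact_range hφ).isClosed hunc
  obtain ⟨E, -, hE, hEP, hmin⟩ := exists_minimal_isCompact_image_eq hφ
    (hP.closed.preimage hφ).isCompact
  rw [image_preimage_eq_of_subset hPφ] at hEP hmin
  obtain ⟨a, haE, U, hU, hUa⟩ := hX E (by rw [← image_nonempty (f := φ), hEP]; exact hPne)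
  have haU : a ∈ U := (hUa.symm ▸ mem_singleton a : a ∈ U ∩ E).1
  have hclosed : IsClosed (φ '' (E \ U)) := ((hE.diff hU).image hφ).isClosed
  have ha : φ a ∉ φ '' (E \ U) := by
    rintro ⟨x, hx, hxa⟩
    have hsurj : φ '' (E \ U) = P := by
      refine Subset.antisymm ((image_mono sdiff_subset).trans hEP.subset) ?_
      rw [← hEP]
      rintro _ ⟨y, hy, rfl⟩
      by_cases hyU : y ∈ U
      · rw [show y = a from hUa.subset ⟨hyU, hy⟩]
        exact ⟨x, hx, hxa⟩
      · exact ⟨y, ⟨hy, hyU⟩, rfl⟩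
    exact ((hmin _ sdiff_subset (hE.diff hU).isClosed hsurj).symm.subset haE).2 haU
  obtain ⟨_, ⟨hyU, hyP⟩, hya⟩ := accPt_iff_nhds.1 (hP.acc (φ a) (hEP ▸ mem_image_of_mem φ haE))
    _ (hclosed.isOpen_compl.mem_nhds ha)
  rw [← hEP] at hyP
  obtain ⟨y, hy, rfl⟩ := hyP
  by_cases h : y ∈ U
  · exact hya (congrArg φ (hUa.subset ⟨h, hy⟩))
  · exact hyU ⟨y, ⟨hy, h⟩, rfl⟩

/-- The one-point compactification of a scattered space is scattered. -/
lemma Scattered.onePoint {X : Type*} [TopologicalSpace X] (hX : Scattered X) :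
    Scattered (OnePoint X) := by
  intro A hA
  by_cases h : ((↑) ⁻¹' A : Set X).Nonempty
  · obtain ⟨a, ha, U, hU, hUa⟩ := hX _ h
    refine ⟨a, ha, (↑) '' U, OnePoint.isOpenEmbedding_coe.isOpenMap U hU, ?_⟩
    rw [← image_inter_preimage, hUa, image_singleton]
  · have hA' : ∀ x ∈ A, x = OnePoint.infty := by
      intro x hx
      induction x using OnePoint.rec with
      | infty => rfl
      | coe x => exact absurd ⟨x, hx⟩ h
    obtain ⟨x, hx⟩ := hA
    refine ⟨x, hx, univ, isOpen_univ, ?_⟩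
    rw [univ_inter]
    exact Subset.antisymm (fun y hy => (hA' y hy).trans (hA' x hx).symm)
      (singleton_subset_iff.2 hx)

/-- In a locally compact scattered space, every disjoint sequence of finite sets has a point-finite
open expansion. -/
lemma Scattered.exists_pointFinite_expansion {X : Type*} [TopologicalSpace X]
    [LocallyCompactSpace X] [T2Space X] (hX : Scattered X) {D : ℕ → Set X}
    (hD : ∀ n, (D n).Finite) (hdisj : Pairwise (Function.onFun Disjoint D)) :
    ∃ O : ℕ → Set X, (∀ n, IsOpen (O n)) ∧ (∀ n, D n ⊆ O n) ∧ ∀ x, {n | x ∈ O n}.Finite := by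
  classical
  let T : Set X := ⋃ n, D n
  have : Countable T := (countable_iUnion fun n => (hD n).countable).to_subtype
  have hsep : ∀ p : T × T, ∃ f : C(OnePoint X, ℝ),
      p.1 ≠ p.2 → f (p.1 : X) ≠ f (p.2 : X) := by
    intro p
    by_cases hp : p.1 = p.2
    · exact ⟨0, fun h => absurd hp h⟩
    · obtain ⟨f, hf1, hf0, -⟩ := exists_continuous_one_zero_of_isCompact
        (isCompact_singleton (x := ((p.1 : X) : OnePoint X)))
        (isClosed_singleton (x := ((p.2 : X) : OnePoint X)))
        (by simpa [Subtype.coe_inj] using hp)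
      refine ⟨f, fun _ => ?_⟩
      rw [hf1 rfl, hf0 rfl]
      exact one_ne_zero
  choose f hf using hsep
  let φ : OnePoint X → (T × T → ℝ) := fun x p => f p x
  have hφ : Continuous φ := continuous_pi fun p => (f p).continuous
  have hinj : ∀ x ∈ T, ∀ y ∈ T, φ x = φ y → x = y := by
    intro x hx y hy hxy
    by_contra hne
    exact hf (⟨x, hx⟩, ⟨y, hy⟩) (fun h => hne (congrArg Subtype.val h)) (congrFun hxy _)
  have : Countable (range φ) := (hX.onePoint.countable_range hφ).to_subtype
  obtain ⟨e, he⟩ := exists_injective_nat (range φ)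
  let ψ : X → (T × T → ℝ) := fun x => φ x
  have hψ : Continuous ψ := hφ.comp OnePoint.continuous_coe
  let code : X → ℕ := fun x => e ⟨ψ x, mem_range_self _⟩
  have hcode : ∀ x y, code x = code y → ψ x = ψ y := fun x y h =>
    congrArg Subtype.val (he h)
  refine ⟨fun n => {x | code x ≤ n → ψ x ∈ ψ '' D n}, fun n => ?_, fun n x hx _ => ⟨x, hx, rfl⟩,
    fun x => ?_⟩
  · have hfin : (ψ '' {x | code x ≤ n}).Finite := by
      refine Finite.of_finite_image (f := fun z => if h : z ∈ range φ then e ⟨z, h⟩ else 0)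
        ((finite_Iic n).subset ?_) ?_
      · rintro _ ⟨_, ⟨x, hx, rfl⟩, rfl⟩
        simpa [ψ] using hx
      · rintro _ ⟨x, -, rfl⟩ _ ⟨y, -, rfl⟩ hxy
        refine hcode x y ?_
        simpa [ψ] using hxy
    have hclosed : IsClosed (ψ ⁻¹' (ψ '' {x | code x ≤ n} \ ψ '' D n)) :=
      (hfin.subset sdiff_subset).isClosed.preimage hψ
    convert hclosed.isOpen_compl using 1
    ext x
    have hx : ψ x ∈ ψ '' {x | code x ≤ n} ↔ code x ≤ n := by
      refine ⟨?_, fun h => ⟨x, h, rfl⟩⟩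
      rintro ⟨y, hy, hyx⟩
      have : code y = code x := by simp only [code, hyx]
      exact this ▸ hy
    simp [hx, -mem_image]
  · have hsub : {n | ψ x ∈ ψ '' D n}.Subsingleton := by
      rintro m ⟨y, hy, hyx⟩ n ⟨z, hz, hzx⟩
      by_contra hmn
      have hyz : y = z := hinj y (mem_iUnion_of_mem m hy) z (mem_iUnion_of_mem n hz)
        (hyx.trans hzx.symm)
      exact disjoint_left.1 (hdisj hmn) hy (hyz ▸ hz)
    refine ((finite_Iio (code x)).union hsub.finite).subset fun n hn => ?_
    by_cases h : code x ≤ n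
    · exact Or.inr (hn h)
    · exact Or.inl (not_le.1 h)

namespace Cp

variable {X : Type*} [TopologicalSpace X]

/-- A continuous map regarded as an element of `Cp X`. -/
def of (f : C(X, ℝ)) : Cp X := f

@[simp]
lemma of_apply (f : C(X, ℝ)) (x : X) : of f x = f x := rfl

protected lemma continuous (f : Cp X) : Continuous f :=
  ContinuousMap.continuous (show C(X, ℝ) from f)

lemma isEmbedding_coe : IsEmbedding (fun f : Cp X => (f : X → ℝ)) :=
  ⟨⟨rfl⟩, DFunLike.coe_injective⟩

lemma continuous_apply (x : X) : Continuous fun f : Cp X => f x :=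
  (_root_.continuous_apply x).comp isEmbedding_coe.continuous

instance : T2Space (Cp X) := isEmbedding_coe.t2Space

lemma exists_finset_eqOn_mem {W : Set (Cp X)} (hW : IsOpen W) {g : Cp X} (hg : g ∈ W) :
    ∃ F : Finset X, ∀ g' : Cp X, EqOn g' g F → g' ∈ W := by
  obtain ⟨V, hV, rfl⟩ := isEmbedding_coe.isOpen_iff.1 hW
  obtain ⟨F, u, hu, hF⟩ := isOpen_pi_iff.1 hV g hg
  refine ⟨F, fun g' hg' => hF fun x hx => ?_⟩
  change g' x ∈ u x
  rw [hg' hx]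
  exact (hu x hx).2

lemma exists_mem_abs_sub_lt {W : Set (Cp X)} {z : Cp X} (hz : z ∈ closure W) (F : Finset X)
    {ε : ℝ} (hε : 0 < ε) : ∃ g ∈ W, ∀ x ∈ F, |g x - z x| < ε := by
  have hopen : IsOpen {g : Cp X | ∀ x ∈ F, |g x - z x| < ε} := by
    have : {g : Cp X | ∀ x ∈ F, |g x - z x| < ε} = ⋂ x ∈ F, {g | |g x - z x| < ε} := by
      ext; simp
    rw [this]
    exact isOpen_biInter_finset fun x _ =>
      isOpen_lt ((continuous_apply x).sub continuous_const).abs continuous_const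
  obtain ⟨g, hg, hgW⟩ := mem_closure_iff.1 hz _ hopen (by simpa using fun _ _ => hε)
  exact ⟨g, hgW, hg⟩

end Cp

/-- If `z` is in the closure of an open set `W` of `Cp X`, there is a sequence of elements of `W`
and finite sets `F n`, such that the `n`-th element is determined to be in `W` by its values on
`F n` and is close to `z` on the preceding finite sets. -/
lemma Cp.exists_seq_finset {X : Type*} [TopologicalSpace X] {W : Set (Cp X)} (hW : IsOpen W)
    {z : Cp X} (hz : z ∈ closure W) :
    ∃ (g : ℕ → Cp X) (F H : ℕ → Finset X), Monotone H ∧ (∀ n, F n ⊆ H (n + 1)) ∧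
      (∀ n, ∀ x ∈ H n, |g n x - z x| < 1 / ((n : ℝ) + 1)) ∧
      ∀ n, ∀ g' : Cp X, EqOn g' (g n) (F n) → g' ∈ W := by
  classical
  choose g hgW hg using fun (n : ℕ) (H : Finset X) =>
    exists_mem_abs_sub_lt hz H (Nat.one_div_pos_of_nat (α := ℝ) (n := n))
  choose F hF using fun (n : ℕ) (H : Finset X) => exists_finset_eqOn_mem hW (hgW n H)
  let H : ℕ → Finset X := fun n => Nat.rec ∅ (fun n H => H ∪ F n H) n
  have hH : ∀ n, H (n + 1) = H n ∪ F n (H n) := fun n => rfl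
  refine ⟨fun n => g n (H n), fun n => F n (H n), H, monotone_nat_of_le_succ fun n => ?_,
    fun n => ?_, fun n => hg n (H n), fun n => hF n (H n)⟩
  · rw [hH]; exact Finset.subset_union_left
  · rw [hH]; exact Finset.subset_union_right

/-- If `X` is locally compact and scattered, then points in the closure of an open set of `Cp X`
are limits of sequences in that set. -/
lemma Scattered.exists_seq_tendsto {X : Type*} [TopologicalSpace X] [LocallyCompactSpace X]
    [T2Space X] (hX : Scattered X) {W : Set (Cp X)} (hW : IsOpen W) {z : Cp X}
    (hz : z ∈ closure W) :
    ∃ g : ℕ → Cp X, (∀ n, g n ∈ W) ∧ Filter.Tendsto g Filter.atTop (𝓝 z) := by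
  obtain ⟨g, F, H, hmono, hFH, hgH, hgW⟩ := Cp.exists_seq_finset hW hz
  have hdisj : Pairwise (Function.onFun Disjoint fun n => (F n \ H n : Set X)) := by
    refine (pairwise_disjoint_on _).2 fun m n hmn => disjoint_left.2 fun x hxm hxn => hxn.2 ?_
    exact hmono hmn (hFH m hxm.1)
  obtain ⟨O, hO, hDO, hfin⟩ := hX.exists_pointFinite_expansion
    (fun n => (F n).finite_toSet.subset sdiff_subset) hdisj
  have hbump : ∀ n, ∃ h : C(X, ℝ), EqOn h 1 (F n \ H n) ∧ EqOn h 0 (O n)ᶜ := by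
    intro n
    obtain ⟨h, h1, h0, -⟩ := exists_continuous_one_zero_of_isCompact
      ((F n).finite_toSet.subset (sdiff_subset (t := (H n : Set X)))).isCompact
      (hO n).isClosed_compl (disjoint_compl_right_iff_subset.2 (hDO n))
    exact ⟨h, h1, h0⟩
  choose h h1 h0 using hbump
  let δ : ℕ → ℝ := fun n => 1 / ((n : ℝ) + 1)
  have hδ : ∀ n, 0 < δ n := fun n => Nat.one_div_pos_of_nat
  let clip : ℕ → ℝ → ℝ := fun n t => max (-δ n) (min t (δ n))
  have hclip : ∀ n, Continuous (clip n) := fun n => by fun_prop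
  have hclip_le : ∀ n t, |clip n t| ≤ δ n := fun n t =>
    abs_le.2 ⟨le_max_left _ _, max_le (by linarith [hδ n]) (min_le_right _ _)⟩
  have hclip_eq : ∀ n t, |t| < δ n → clip n t = t := fun n t ht => by
    rw [abs_lt] at ht
    simp only [clip]
    rw [min_eq_left ht.2.le, max_eq_right ht.1.le]
  let u : ℕ → C(X, ℝ) := fun n =>
    ⟨fun x => z x + (clip n (g n x - z x) + (g n x - z x - clip n (g n x - z x)) * h n x), by
      have := z.continuous
      have := (g n).continuous
      have := hclip n
      fun_prop⟩
  have hu : ∀ n x, u n x =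
    z x + (clip n (g n x - z x) + (g n x - z x - clip n (g n x - z x)) * h n x) := fun n x => rfl
  refine ⟨fun n => Cp.of (u n), fun n => hgW n _ fun x hx => ?_, ?_⟩
  · rw [Cp.of_apply, hu]
    by_cases hxH : x ∈ H n
    · rw [hclip_eq n _ (hgH n x hxH)]
      ring
    · rw [h1 n ⟨hx, hxH⟩]
      simp
  · rw [Cp.isEmbedding_coe.tendsto_nhds_iff, tendsto_pi_nhds]
    intro x
    refine tendsto_iff_dist_tendsto_zero.2 (squeeze_zero' (.of_forall fun _ => dist_nonneg) ?_
      (tendsto_one_div_add_atTop_nhds_zero_nat (𝕜 := ℝ)))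
    have hev : ∀ᶠ n in Filter.atTop, x ∉ O n := by
      rw [← Nat.cofinite_eq_atTop, Filter.eventually_cofinite]
      simpa using hfin x
    filter_upwards [hev] with n hn
    have : Cp.of (u n) x - z x = clip n (g n x - z x) := by
      rw [Cp.of_apply, hu, h0 n hn]
      simp
    simp only [Function.comp_apply, Real.dist_eq, this]
    exact hclip_le n _

/-- A compact family of continuous functions is equicontinuous along convergent sequences. -/
lemma IsCompact.eventually_forall_mem_of_tendsto {Y : Type*} [TopologicalSpace Y] [T2Space Y]
    {K : Set C(Y, ℝ)} (hK : IsCompact K) {y : ℕ → Y} {z : Y}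
    (hy : Filter.Tendsto y Filter.atTop (𝓝 z)) {V : Set ℝ} (hV : IsOpen V)
    (hKV : ∀ f ∈ K, f z ∈ V) : ∀ᶠ n in Filter.atTop, ∀ f ∈ K, f (y n) ∈ V := by
  let S : Set Y := insert z (range y)
  have : CompactSpace S := isCompact_iff_compactSpace.1 hy.isCompact_insert_range
  let z' : S := ⟨z, mem_insert z _⟩
  let y' : ℕ → S := fun n => ⟨y n, mem_insert_of_mem _ (mem_range_self n)⟩
  have hy' : Filter.Tendsto y' Filter.atTop (𝓝 z') := tendsto_subtype_rng.2 hy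
  have hcont : Continuous fun p : S × C(Y, ℝ) => p.2.restrict S p.1 :=
    ((ContinuousMap.continuous_restrict S).comp continuous_snd).eval continuous_fst
  exact hy'.eventually (hK.eventually_forall_of_forall_eventually
    (P := fun s f => f.restrict S s ∈ V) fun f hf => hcont.continuousAt (hV.mem_nhds (hKV f hf)))

/-- A Hausdorff space in which points in the closure of an open set are limits of sequences in that
set has continuous evaluation map. -/
lemma continuous_eval_of_exists_seq_tendsto {Y : Type*} [TopologicalSpace Y] [T2Space Y]
    (hY : ∀ W : Set Y, IsOpen W → ∀ z ∈ closure W,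
      ∃ y : ℕ → Y, (∀ n, y n ∈ W) ∧ Filter.Tendsto y Filter.atTop (𝓝 z)) :
    Continuous fun y : Y =>
      (⟨fun f : C(Y, ℝ) => f y, ContinuousEvalConst.continuous_eval_const y⟩ : C(C(Y, ℝ), ℝ)) := by
  refine ContinuousMap.continuous_compactOpen.2 fun K hK U hU => isOpen_iff_mem_nhds.2 fun z hz => ?_
  have hKz : IsCompact ((fun f : C(Y, ℝ) => f z) '' K) :=
    hK.image (ContinuousEvalConst.continuous_eval_const z)
  obtain ⟨V, hV, hKV, hVU⟩ := normal_exists_closure_subset hKz.isClosed hU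
    (image_subset_iff.2 hz)
  let W : Set Y := ⋃ f ∈ K, f ⁻¹' (closure V)ᶜ
  have hW : IsOpen W := isOpen_biUnion fun f _ => isClosed_closure.isOpen_compl.preimage f.continuous
  have hzW : z ∉ closure W := by
    intro hzW
    obtain ⟨y, hyW, hy⟩ := hY W hW z hzW
    obtain ⟨n, hn⟩ := (hK.eventually_forall_mem_of_tendsto hy hV
      fun f hf => hKV (mem_image_of_mem _ hf)).exists
    obtain ⟨f, hf, hfy⟩ := mem_iUnion₂.1 (hyW n)
    exact hfy (subset_closure (hn f hf))
  filter_upwards [isClosed_closure.isOpen_compl.mem_nhds hzW] with y hy f hf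
  by_contra hfy
  exact hy (subset_closure (mem_iUnion₂.2 ⟨f, hf, fun h => hfy (hVU h)⟩))

lemma Scattered.ascoliSpace_cp {X : Type*} [TopologicalSpace X] [LocallyCompactSpace X]
    [T2Space X] (hX : Scattered X) : AscoliSpace (Cp X) := by
  have hδ := continuous_eval_of_exists_seq_tendsto fun W hW z hz =>
    hX.exists_seq_tendsto (W := W) hW (z := z) hz
  refine IsEmbedding.of_comp (g := fun (Φ : C(C(Cp X, ℝ), ℝ)) (x : X) =>
    Φ ⟨fun f => f x, Cp.continuous_apply x⟩) hδ ?_ Cp.isEmbedding_coe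
  exact continuous_pi fun x => ContinuousEvalConst.continuous_eval_const _

/-- An open set meeting a dense-in-itself set `A` contains the closures of two open sets which
meet `A` and have disjoint closures. -/
lemma exists_two_isOpen_closure_subset {X : Type*} [TopologicalSpace X] [T3Space X] {A U : Set X}
    (hA : ∀ a ∈ A, ∀ V : Set X, IsOpen V → V ∩ A ≠ {a}) (hU : IsOpen U)
    (hUA : (U ∩ A).Nonempty) :
    ∃ V : Bool → Set X, (∀ b, IsOpen (V b) ∧ (V b ∩ A).Nonempty) ∧ (∀ b, closure (V b) ⊆ U) ∧
      ∀ b c, b ≠ c → Disjoint (closure (V b)) (closure (V c)) := by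
  obtain ⟨a, haU, haA⟩ := hUA
  obtain ⟨a', ⟨haU', haA'⟩, hne⟩ : ∃ a' ∈ U ∩ A, a' ≠ a := by
    by_contra! h
    exact hA a haA U hU (Subset.antisymm h (singleton_subset_iff.2 ⟨haU, haA⟩))
  obtain ⟨u, hau, hu, v, hav, hv, huv⟩ := exists_open_nhds_disjoint_closure hne
  have hshrink : ∀ x ∈ U, ∀ w, IsOpen w → x ∈ w →
      ∃ V, IsOpen V ∧ x ∈ V ∧ closure V ⊆ U ∧ closure V ⊆ closure w := by
    intro x hx w hw hxw
    obtain ⟨t, ht, htc, htU⟩ := exists_mem_nhds_isClosed_subset (hU.mem_nhds hx)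
    refine ⟨interior t ∩ w, isOpen_interior.inter hw, ⟨mem_interior_iff_mem_nhds.2 ht, hxw⟩, ?_,
      closure_mono inter_subset_right⟩
    exact (closure_minimal (inter_subset_left.trans interior_subset) htc).trans htU
  obtain ⟨V, hV, hVa, hVU, hVu⟩ := hshrink a' haU' u hu hau
  obtain ⟨V', hV', hVa', hVU', hVv⟩ := hshrink a haU v hv hav
  refine ⟨fun b => bif b then V else V', ?_, ?_, ?_⟩
  · rintro (_ | _)
    · exact ⟨hV', a, hVa', haA⟩
    · exact ⟨hV, a', hVa, haA'⟩
  · rintro (_ | _)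
    · exact hVU'
    · exact hVU
  · rintro (_ | _) (_ | _) h
    · exact absurd rfl h
    · exact (huv.mono hVu hVv).symm
    · exact huv.mono hVu hVv
    · exact absurd rfl h

lemma isOpen_setOf_piNat_res_eq (n : ℕ) (l : List Bool) :
    IsOpen {b : ℕ → Bool | PiNat.res b n = l} := by
  induction n generalizing l with
  | zero => simp
  | succ n ih =>
    cases l with
    | nil => simp
    | cons c l =>
      simp only [PiNat.res_succ, List.cons.injEq, ofPred_and]
      exact ((isOpen_discrete {c}).preimage (continuous_apply n)).inter (ih l)

/-- A locally compact Hausdorff space that is not scattered contains a compact set mapping onto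
the Cantor space; the map is given by its graph. -/
lemma exists_isCompact_graph_of_not_scattered {X : Type*} [TopologicalSpace X]
    [LocallyCompactSpace X] [T2Space X] (hX : ¬ Scattered X) :
    ∃ R : Set (X × (ℕ → Bool)), IsCompact R ∧ (∀ b, ∃ x, (x, b) ∈ R) ∧
      ∀ x b c, (x, b) ∈ R → (x, c) ∈ R → b = c := by
  unfold Scattered at hX
  push Not at hX
  obtain ⟨A, ⟨a, ha⟩, hA⟩ := hX
  obtain ⟨K, hK, haK⟩ := exists_compact_mem_nhds a
  choose V hV hVU hVdisj using fun U : {U : Set X // IsOpen U ∧ (U ∩ A).Nonempty} =>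
    exists_two_isOpen_closure_subset hA U.2.1 U.2.2
  let U : List Bool → {U : Set X // IsOpen U ∧ (U ∩ A).Nonempty} := fun l =>
    List.rec ⟨interior K, isOpen_interior, a, mem_interior_iff_mem_nhds.2 haK, ha⟩
      (fun b _ U => ⟨V U b, hV U b⟩) l
  have hUcons : ∀ b l, (U (b :: l)).1 = V (U l) b := fun b l => rfl
  have hcompact : IsCompact (closure (U []).1) :=
    hK.of_isClosed_subset isClosed_closure (closure_minimal interior_subset hK.isClosed)
  let R : Set (X × (ℕ → Bool)) := {p | ∀ n, p.1 ∈ closure (U (PiNat.res p.2 n)).1}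
  have hR : IsClosed R := by
    have : R = ⋂ (n) (l), {p | PiNat.res p.2 n = l → p.1 ∈ closure (U l).1} := by
      ext p; simp [R]
    rw [this]
    exact isClosed_iInter fun n => isClosed_iInter fun l =>
      isClosed_imp ((isOpen_setOf_piNat_res_eq n l).preimage continuous_snd)
        (isClosed_closure.preimage continuous_fst)
  refine ⟨R, (hcompact.prod isCompact_univ).of_isClosed_subset hR
    fun p hp => ⟨hp 0, mem_univ _⟩, fun b => ?_, fun x b c hb hc => ?_⟩
  · obtain ⟨x, hx⟩ := IsCompact.nonempty_iInter_of_sequence_nonempty_isCompact_isClosed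
      (fun n => closure (U (PiNat.res b n)).1)
      (fun n => by
        rw [PiNat.res_succ, hUcons]
        exact (hVU _ _).trans subset_closure)
      (fun n => (U (PiNat.res b n)).2.2.left.closure) hcompact (fun n => isClosed_closure)
    exact ⟨x, mem_iInter.1 hx⟩
  · apply PiNat.res_injective
    ext n : 1
    induction n with
    | zero => rfl
    | succ n ih =>
      rw [PiNat.res_succ, PiNat.res_succ, ih]
      congr 1
      by_contra hne
      have hxb := hb (n + 1)
      have hxc := hc (n + 1)
      simp only [PiNat.res_succ, ih, hUcons] at hxb hxc
      exact disjoint_left.1 (hVdisj _ _ _ hne) hxb hxc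

/-- If a compact set is minimal among those mapping onto `Z` and is covered by countably
many closed sets, then one of them contains the part of the compact set over a nonempty open set. -/
lemma exists_isOpen_preimage_subset_of_minimal {Y Z : Type*} [TopologicalSpace Y] [T2Space Y]
    [TopologicalSpace Z] [T2Space Z] [Nonempty Z] {φ : Y → Z} (hφ : Continuous φ) {E : Set Y}
    (hE : IsCompact E) (hsurj : φ '' E = univ)
    (hmin : ∀ C ⊆ E, IsClosed C → φ '' C = univ → C = E) {B : ℕ → Set Y}
    (hB : ∀ m, IsClosed (B m)) (hcover : E ⊆ ⋃ m, B m) :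
    ∃ m, ∃ V : Set Z, IsOpen V ∧ V.Nonempty ∧ E ∩ φ ⁻¹' V ⊆ B m := by
  have : CompactSpace E := isCompact_iff_compactSpace.1 hE
  have : Nonempty E := by
    rw [nonempty_coe_sort, ← image_nonempty (f := φ), hsurj]
    exact univ_nonempty
  obtain ⟨m, x, hx⟩ := nonempty_interior_of_iUnion_of_closed
    (fun m => (hB m).preimage (continuous_subtype_val (p := (· ∈ E))))
    (by rw [← preimage_iUnion, preimage_eq_univ_iff, Subtype.range_coe]; exact hcover)
  obtain ⟨O, hOB, hO, hxO⟩ := mem_interior.1 hx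
  obtain ⟨W, hW, rfl⟩ := isOpen_induced_iff.1 hO
  have hclosed : IsClosed (φ '' (E \ W)) := ((hE.diff hW).image hφ).isClosed
  refine ⟨m, (φ '' (E \ W))ᶜ, hclosed.isOpen_compl, ?_, ?_⟩
  · rw [nonempty_compl]
    intro h
    exact ((hmin _ sdiff_subset (hE.diff hW).isClosed h).symm.subset x.2).2 hxO
  · rintro y ⟨hyE, hy⟩
    by_contra hyB
    exact hy ⟨y, ⟨hyE, fun hyW => hyB (hOB (show (⟨y, hyE⟩ : E) ∈ _ from hyW))⟩, rfl⟩

/-- In a locally compact Hausdorff space that is not scattered there are, for each `n`, `n + 1`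
disjoint finite sets, such that all but finitely many of these sets meet some member of
any given countable closed cover. -/
lemma exists_points_of_not_scattered {X : Type*} [TopologicalSpace X]
    [LocallyCompactSpace X] [T2Space X] (hX : ¬ Scattered X) :
    ∃ y : ∀ n : ℕ, (Fin n → Bool) → Fin (n + 1) → X,
      (∀ n s i t j, y n s i = y n t j → s = t ∧ i = j) ∧
      ∀ B : ℕ → Set X, (∀ m, IsClosed (B m)) → ⋃ m, B m = univ →
        ∃ m N, ∀ n ≥ N, ∀ i, ∃ s, y n s i ∈ B m := by
  obtain ⟨R, hR, hRsurj, hRinj⟩ := exists_isCompact_graph_of_not_scattered hX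
  obtain ⟨E, hER, hE, hsurj, hmin⟩ := exists_minimal_isCompact_image_eq
    (continuous_snd (X := X) (Y := ℕ → Bool)) hR
  have hRuniv : Prod.snd '' R = univ := eq_univ_of_forall fun b => by
    obtain ⟨x, hx⟩ := hRsurj b
    exact ⟨_, hx, rfl⟩
  rw [hRuniv] at hsurj hmin
  have hex : ∀ b, ∃ x, (x, b) ∈ E := fun b => by
    obtain ⟨⟨x, _⟩, hx, rfl⟩ := hsurj.symm.subset (mem_univ b)
    exact ⟨x, hx⟩
  choose x hx using hex
  let b : ∀ n : ℕ, (Fin n → Bool) → Fin (n + 1) → ℕ → Bool := fun n s i k =>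
    if h : k < n then s ⟨k, h⟩ else decide (k = n + i)
  have hb : ∀ n s i t j, b n s i = b n t j → s = t ∧ i = j := by
    intro n s i t j h
    constructor
    · ext k : 1
      simpa [b] using congrFun h k
    · simpa [b, Fin.ext_iff] using congrFun h (n + i)
  refine ⟨fun n s i => x (b n s i), fun n s i t j h => hb n s i t j ?_, fun B hB hcover => ?_⟩
  · exact hRinj _ _ _ (hER (hx _)) (by beta_reduce at h; rw [h]; exact hER (hx _))
  · obtain ⟨m, V, hV, ⟨c, hc⟩, hVB⟩ := exists_isOpen_preimage_subset_of_minimal continuous_snd hE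
      hsurj hmin (fun m => (hB m).preimage continuous_fst)
      (by rw [← preimage_iUnion, hcover]; exact subset_univ _)
    obtain ⟨I, u, hu, hI⟩ := isOpen_pi_iff.1 hV c hc
    obtain ⟨N, hN⟩ := I.bddAbove
    refine ⟨m, N + 1, fun n hn i => ⟨fun k => c k, ?_⟩⟩
    refine hVB ⟨hx _, hI fun k hk => ?_⟩
    have hkn : k < n := lt_of_le_of_lt (hN hk) hn
    simpa [b, hkn] using (hu k hk).2

/-- Given finitely many distinct points, there are continuous functions taking the value `1` at
the respective points which are nowhere simultaneously nonzero. -/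
lemma exists_disjoint_bumps {X : Type*} [TopologicalSpace X] [LocallyCompactSpace X] [T2Space X]
    {ι : Type*} [Finite ι] {y : ι → X} (hy : Function.Injective y) :
    ∃ h : ι → C(X, ℝ), (∀ i, h i (y i) = 1) ∧ ∀ x i j, h i x ≠ 0 → h j x ≠ 0 → i = j := by
  obtain ⟨U, hU, hdisj⟩ := (finite_range y).t2_separation
  have hbump : ∀ i, ∃ h : C(X, ℝ), h (y i) = 1 ∧ EqOn h 0 (U (y i))ᶜ := by
    intro i
    obtain ⟨h, h1, h0, -⟩ := exists_continuous_one_zero_of_isCompact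
      (isCompact_singleton (x := y i)) (hU (y i)).2.isClosed_compl (by simpa using (hU (y i)).1)
    exact ⟨h, h1 rfl, h0⟩
  choose h h1 h0 using hbump
  refine ⟨h, h1, fun x i j hi hj => ?_⟩
  by_contra hij
  have hmem : ∀ k, h k x ≠ 0 → x ∈ U (y k) := fun k hk => by
    by_contra hx
    exact hk (h0 k hx)
  exact disjoint_left.1 (hdisj (mem_range_self i) (mem_range_self j) (hy.ne hij))
    (hmem i hi) (hmem j hj)

/-- A compact set of continuous functions is bounded at each point. -/
lemma Cp.iUnion_setOf_forall_abs_le {X : Type*} [TopologicalSpace X] {C : Set (Cp X)}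
    (hC : IsCompact C) : ⋃ m : ℕ, {x : X | ∀ f ∈ C, |f x| ≤ m} = univ := by
  refine eq_univ_of_forall fun x => ?_
  obtain ⟨M, hM⟩ := hC.exists_bound_of_continuousOn (Cp.continuous_apply x).continuousOn
  obtain ⟨m, hm⟩ := exists_nat_ge M
  exact mem_iUnion.2 ⟨m, fun f hf => (hM f hf).trans hm⟩

lemma AscoliSpace.scattered {X : Type*} [TopologicalSpace X] [LocallyCompactSpace X] [T2Space X]
    (hX : AscoliSpace (Cp X)) : Scattered X := by
  by_contra hscat
  obtain ⟨y, hyinj, hy⟩ := exists_points_of_not_scattered hscat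
  let g : (Σ n : ℕ, Fin (n + 1)) → C(Cp X, ℝ) := fun p =>
    ⟨fun f => ∏ s, max 0 (|f (y p.1 s p.2)| - p.1), continuous_finsetProd _ fun s _ =>
      continuous_const.max ((Cp.continuous_apply _).abs.sub continuous_const)⟩
  have hg : ∀ p f, g p f = ∏ s, max 0 (|f (y p.1 s p.2)| - p.1) := fun p f => rfl
  have hg0 : ∀ p f s, |f (y p.1 s p.2)| ≤ p.1 → g p f = 0 := fun p f s hs =>
    Finset.prod_eq_zero (Finset.mem_univ s) (max_eq_left (sub_nonpos.2 hs))
  have hlim : Filter.Tendsto g Filter.cofinite (𝓝 0) := by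
    refine ContinuousMap.tendsto_iff_forall_isCompact_tendstoUniformlyOn.2 fun C hC => ?_
    obtain ⟨m, N, hmN⟩ := hy (fun m => {x | ∀ f ∈ C, |f x| ≤ m})
      (fun m => by
        simp only [ofPred_forall]
        exact isClosed_biInter fun f _ => isClosed_le f.continuous.abs continuous_const)
      (Cp.iUnion_setOf_forall_abs_le hC)
    have hev : ∀ᶠ p : Σ n : ℕ, Fin (n + 1) in Filter.cofinite, max m N ≤ p.1 := by
      rw [Filter.eventually_cofinite]
      refine ((Set.finite_Iio (max m N)).biUnion fun n _ =>
        finite_range (Sigma.mk (β := fun n => Fin (n + 1)) n)).subset ?_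
      rintro ⟨n, i⟩ hp
      exact mem_biUnion (mem_Iio.2 (not_le.1 hp)) (mem_range_self i)
    refine Metric.tendstoUniformlyOn_iff.2 fun ε hε => ?_
    filter_upwards [hev] with p hp f hf
    obtain ⟨s, hs⟩ := hmN p.1 ((le_max_right _ _).trans hp) p.2
    rw [hg0 p f s ((hs f hf).trans (Nat.cast_le.2 ((le_max_left _ _).trans hp)))]
    simpa using hε
  have hopen : IsOpen {f : Cp X | ∀ k ∈ insert 0 (range g), k f ∈ Iio (1 : ℝ)} :=
    (ContinuousMap.isOpen_setOfPred_mapsTo hlim.isCompact_insert_range_of_cofinite isOpen_Iio).preimage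
      hX.continuous
  obtain ⟨F, hF⟩ := Cp.exists_finset_eqOn_mem hopen (g := Cp.of 0) (by
    rintro k (rfl | ⟨p, rfl⟩)
    · simp
    · rw [hg0 p _ (fun _ => false) (by simp)]
      simp)
  let n := F.card
  obtain ⟨h, h1, hdisj⟩ := exists_disjoint_bumps
    (y := fun q : (Fin n → Bool) × Fin (n + 1) => y n q.1 q.2)
    (fun q r hqr => Prod.ext_iff.2 (hyinj n _ _ _ _ hqr))
  obtain ⟨i, hi⟩ : ∃ i, ∀ x ∈ F, ∀ s, h (s, i) x = 0 := by
    by_contra! hcon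
    choose x hxF s hs using hcon
    have hcard := Finset.card_le_card_of_injOn x (s := Finset.univ) (fun i _ => hxF i)
      (fun i _ j _ hij => (Prod.ext_iff.1 (hdisj (x i) _ _ (hs i) (hij ▸ hs j))).2)
    simp [n] at hcard
  let a : C(X, ℝ) := (n + 1 : ℝ) • ∑ s, h (s, i)
  have ha : ∀ x, a x = (n + 1) * ∑ s, h (s, i) x := fun x => by simp [a]
  have hay : ∀ s, a (y n s i) = n + 1 := fun s => by
    rw [ha, Finset.sum_eq_single s, h1 (s, i), mul_one]
    · intro t _ hts
      by_contra ht
      exact hts (Prod.ext_iff.1 (hdisj _ _ _ ht (by rw [h1 (s, i)]; exact one_ne_zero))).1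
    · simp
  have hlt : g ⟨n, i⟩ (Cp.of a) < 1 := hF (Cp.of a)
    (fun x hx => by simp [ha, hi x hx]) _ (Or.inr ⟨_, rfl⟩)
  refine hlt.ne ?_
  rw [hg]
  refine Finset.prod_eq_one fun s _ => ?_
  rw [Cp.of_apply, hay, abs_of_nonneg (by positivity)]
  simp

/-- For a locally compact Hausdorff space `X`, the space `C_p(X)` is Ascoli if and
only if `X` is scattered. -/
theorem cp_ascoli_iff_scattered (X : Type*) [TopologicalSpace X]
    [LocallyCompactSpace X] [T2Space X] :
    AscoliSpace (Cp X) ↔ Scattered X :=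
  ⟨AscoliSpace.scattered, Scattered.ascoliSpace_cp⟩
end
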